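/- arXiv:2106.03080 — 3 statements merged into one kernel-verified Lean document; each statement's English description precedes it below -/
import Mathlib

section
/- Let K_{r,s} be the complete bipartite graph with 3 ≤ r ≤ s and total order n = r + s. Then ψ(K_{r,s}) = n − 2. -/
open SimpleGraph

/-- Vertices `u, v` are doubly resolved by vertices `x, y` if
`d(u,x) − d(v,x) ≠ d(u,y) − d(v,y)`. -/
def doublyResolves {V : Type*} (G : SimpleGraph V) (x y u v : V) : Prop :=
  (G.dist u x : ℤ) - (G.dist v x : ℤ) ≠ (G.dist u y : ℤ) - (G.dist v y : ℤ)

/-- A set `W` of vertices is a doubly resolving set for `G` if every two distinct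
vertices of `G` are doubly resolved by some two vertices of `W`. -/
def IsDoublyResolvingSet {V : Type*} (G : SimpleGraph V) (W : Set V) : Prop :=
  ∀ u v : V, u ≠ v → ∃ x ∈ W, ∃ y ∈ W, doublyResolves G x y u v

/-- The doubly resolving number `ψ(G)`: the minimum cardinality of a doubly
resolving set for `G`. -/
noncomputable def psi {V : Type*} (G : SimpleGraph V) : ℕ :=
  sInf {k | ∃ W : Finset V, W.card = k ∧ IsDoublyResolvingSet G ↑W}

lemma kdist_lr {r s : ℕ} (a : Fin r) (b : Fin s) :
    (completeBipartiteGraph (Fin r) (Fin s)).dist (Sum.inl a) (Sum.inr b) = 1 := by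
  rw [SimpleGraph.dist_eq_one_iff_adj]; simp

lemma kdist_rl {r s : ℕ} (a : Fin r) (b : Fin s) :
    (completeBipartiteGraph (Fin r) (Fin s)).dist (Sum.inr b) (Sum.inl a) = 1 := by
  rw [SimpleGraph.dist_eq_one_iff_adj]; simp

/-- Non-adjacent distinct vertices with a common neighbour are at distance two. -/
lemma dist_two_aux {V : Type*} (G : SimpleGraph V) {u v w : V} (h1 : G.Adj u w) (h2 : G.Adj w v)
    (hne : u ≠ v) (hna : ¬ G.Adj u v) : G.dist u v = 2 := by
  let p : G.Walk u v := SimpleGraph.Walk.cons h1 (SimpleGraph.Walk.cons h2 SimpleGraph.Walk.nil)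
  have hle : G.dist u v ≤ 2 := SimpleGraph.dist_le p
  have hlt := SimpleGraph.Reachable.one_lt_dist_of_ne_of_not_adj ⟨p⟩ hne hna
  omega

lemma kdist_ll {r s : ℕ} (hs : 0 < s) (a b : Fin r) :
    (completeBipartiteGraph (Fin r) (Fin s)).dist (Sum.inl a) (Sum.inl b)
      = if a = b then 0 else 2 := by
  split_ifs with h
  · simp [h]
  · exact dist_two_aux _ (w := Sum.inr ⟨0, hs⟩) (by simp) (by simp) (by simpa using h) (by simp)

lemma kdist_rr {r s : ℕ} (hr : 0 < r) (a b : Fin s) :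
    (completeBipartiteGraph (Fin r) (Fin s)).dist (Sum.inr a) (Sum.inr b)
      = if a = b then 0 else 2 := by
  split_ifs with h
  · simp [h]
  · exact dist_two_aux _ (w := Sum.inl ⟨0, hr⟩) (by simp) (by simp) (by simpa using h) (by simp)

/-- In `Fin n` with `n ≥ 3` we can avoid any two given elements. -/
lemma exists_avoid {n : ℕ} (hn : 3 ≤ n) (a b : Fin n) : ∃ c : Fin n, c ≠ a ∧ c ≠ b := by
  have hc : ({a, b} : Finset (Fin n)).card < (Finset.univ : Finset (Fin n)).card := by
    have := Finset.card_le_two (a := a) (b := b)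
    simp only [Finset.card_univ, Fintype.card_fin]
    omega
  obtain ⟨c, -, hc⟩ := Finset.exists_mem_notMem_of_card_lt_card hc
  exact ⟨c, by simpa using hc⟩

lemma k_upper {r s : ℕ} (hr : 3 ≤ r) (hs : 3 ≤ s) (a : Fin r) (b : Fin s) :
    IsDoublyResolvingSet (completeBipartiteGraph (Fin r) (Fin s))
      (↑(({Sum.inl a, Sum.inr b} : Finset (Fin r ⊕ Fin s))ᶜ)) := by
  have hr0 : 0 < r := by omega
  have hs0 : 0 < s := by omega
  have hL := fun x y => kdist_ll (r := r) hs0 x y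
  have hR := fun x y => kdist_rr (s := s) hr0 x y
  rintro (u | u) (v | v) huv
  · have huv : u ≠ v := by simpa using huv
    obtain ⟨y, hy, -⟩ := exists_avoid hs b b
    by_cases hu : u = a
    · refine ⟨Sum.inl v, by simp; grind, Sum.inr y, by simpa using hy, ?_⟩
      simp [doublyResolves, hL, kdist_lr, huv]
    · refine ⟨Sum.inl u, by simpa using hu, Sum.inr y, by simpa using hy, ?_⟩
      simp [doublyResolves, hL, kdist_lr, huv.symm]
  · obtain ⟨x, hx, hxu⟩ := exists_avoid hr a u
    obtain ⟨y, hy, hyv⟩ := exists_avoid hs b v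
    refine ⟨Sum.inl x, by simpa using hx, Sum.inr y, by simpa using hy, ?_⟩
    simp [doublyResolves, hL, hR, kdist_lr, kdist_rl, hxu.symm, hyv.symm]
  · obtain ⟨x, hx, hxv⟩ := exists_avoid hr a v
    obtain ⟨y, hy, hyu⟩ := exists_avoid hs b u
    refine ⟨Sum.inl x, by simpa using hx, Sum.inr y, by simpa using hy, ?_⟩
    simp [doublyResolves, hL, hR, kdist_lr, kdist_rl, hxv.symm, hyu.symm]
  · have huv : u ≠ v := by simpa using huv
    obtain ⟨y, hy, -⟩ := exists_avoid hr a a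
    by_cases hu : u = b
    · refine ⟨Sum.inr v, by simp; grind, Sum.inl y, by simpa using hy, ?_⟩
      simp [doublyResolves, hR, kdist_rl, huv]
    · refine ⟨Sum.inr u, by simpa using hu, Sum.inl y, by simpa using hy, ?_⟩
      simp [doublyResolves, hR, kdist_rl, huv.symm]

lemma k_lower {r s : ℕ} (hr : 0 < r) (hs : 0 < s) (W : Finset (Fin r ⊕ Fin s))
    (hW : IsDoublyResolvingSet (completeBipartiteGraph (Fin r) (Fin s)) ↑W) :
    r + s - 2 ≤ W.card := by
  have hL := fun x y => kdist_ll (r := r) hs x y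
  have hR := fun x y => kdist_rr (s := s) hr x y
  have hinj : Set.InjOn (Sum.isLeft : Fin r ⊕ Fin s → Bool) ↑(Wᶜ) := by
    intro u hu v hv huv
    by_contra hne
    obtain ⟨x, hx, y, hy, hxy⟩ := hW u v hne
    have key : ∀ z ∈ W, (completeBipartiteGraph (Fin r) (Fin s)).dist u z
        = (completeBipartiteGraph (Fin r) (Fin s)).dist v z := by
      intro z hz
      have hzu : u ≠ z := by rintro rfl; simp at hu; exact hu hz
      have hzv : v ≠ z := by rintro rfl; simp at hv; exact hv hz
      rcases u with u | u <;> rcases v with v | v <;> rcases z with z | z <;>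
        simp_all [kdist_lr, kdist_rl]
    apply hxy
    rw [key x hx, key y hy]
    simp
  have h1 := Finset.card_le_card_of_injOn (t := (Finset.univ : Finset Bool)) Sum.isLeft
    (by intro x _; exact Finset.mem_coe.2 (Finset.mem_univ _)) hinj
  have h2 := Finset.card_add_card_compl W
  simp only [Fintype.card_sum, Fintype.card_fin, Finset.card_univ, Fintype.card_bool] at h1 h2
  omega

/-- For the complete bipartite graph `K_{r,s}` with `3 ≤ r ≤ s` and `n = r + s`,
the doubly resolving number is `n − 2`. -/
theorem stmt_4 (r s : ℕ) (hr : 3 ≤ r) (hrs : r ≤ s) :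
    psi (completeBipartiteGraph (Fin r) (Fin s)) = r + s - 2 := by
  have hs : 3 ≤ s := hr.trans hrs
  apply le_antisymm
  · apply Nat.sInf_le
    refine ⟨({Sum.inl ⟨0, by omega⟩, Sum.inr ⟨0, by omega⟩})ᶜ, ?_, k_upper hr hs _ _⟩
    rw [Finset.card_compl, Finset.card_pair (by simp)]
    simp
  · refine le_csInf ⟨_, _, rfl, k_upper hr hs ⟨0, by omega⟩ ⟨0, by omega⟩⟩ ?_
    rintro k ⟨W, rfl, hW⟩
    exact k_lower (by omega) (by omega) W hW
end

section
/- Let G be a finite simple connected unicyclic graph with unique cycle C(G), and let W be a doubly resolving set for the cycle C(G) (viewed as a graph with its own cycle distance). If every vertex of W has degree at least 3 in G, then the set L(G) of leaves of G is a doubly resolving set for G of minimum cardinality (a doubly basis of G). -/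
open SimpleGraph

/-- `z` lies on the `w`-side of the edge `wy`. -/
def OnSide {V : Type*} (G : SimpleGraph V) (w y z : V) : Prop :=
  (G.deleteEdges {s(w, y)}).Reachable z w

section aux
variable {V : Type*} {G : SimpleGraph V}

lemma onSide_step {w y z z' : V} (h : OnSide G w y z') (ha : G.Adj z z')
    (hne : s(z, z') ≠ s(w, y)) : OnSide G w y z := by
  refine Reachable.trans (Adj.reachable ?_) h
  simp [ha, hne]

lemma onSide_self (w y : V) : OnSide G w y w := Reachable.refl _

lemma onSide_not_both {w y z : V} (hb : G.IsBridge s(w, y)) (h : OnSide G w y z)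
    (h' : OnSide G y w z) : False := by
  unfold OnSide at h h'
  rw [Sym2.eq_swap] at h'
  exact (isBridge_iff.1 hb) (h.symm.trans h')

lemma onSide_or (hG : G.Connected) (w y z : V) : OnSide G w y z ∨ OnSide G y w z := by
  obtain ⟨p⟩ := hG z w
  induction p with
  | nil => left; exact onSide_self _ _
  | @cons a b w' h p ih =>
    by_cases he : s(a, b) = s(w', y)
    · rcases Sym2.eq_iff.1 he with ⟨rfl, rfl⟩ | ⟨rfl, rfl⟩
      · left; exact onSide_self _ _
      · right; exact onSide_self _ _
    · rcases ih with ih | ih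
      · left; exact onSide_step ih h he
      · right; exact onSide_step ih h (by rw [Sym2.eq_swap (a := y)]; exact he)

lemma dist_bridge (hG : G.Connected) {w y z x : V} (ha : G.Adj w y) (hb : G.IsBridge s(w, y))
    (hz : OnSide G w y z) (hx : OnSide G y w x) :
    G.dist z x = G.dist z w + 1 + G.dist y x := by
  apply le_antisymm
  · have h1 : G.dist z x ≤ G.dist z w + G.dist w x := hG.dist_triangle
    have h2 : G.dist w x ≤ G.dist w y + G.dist y x := hG.dist_triangle
    rw [dist_eq_one_iff_adj.2 ha] at h2
    omega
  · obtain ⟨p, hp⟩ := hG.exists_walk_length_eq_dist z x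
    rw [← hp]
    clear hp
    induction p with
    | nil => exact (onSide_not_both hb hz hx).elim
    | @cons a b x' h p ih =>
      rw [Walk.length_cons]
      by_cases he : s(a, b) = s(w, y)
      · rcases Sym2.eq_iff.1 he with ⟨rfl, rfl⟩ | ⟨rfl, rfl⟩
        · have := dist_le p
          simp; omega
        · exact (onSide_not_both hb hz (onSide_self _ _)).elim
      · have := ih (onSide_step hz h.symm (by rw [Sym2.eq_swap]; exact he)) hx
        have h2 : G.dist a w ≤ G.dist a b + G.dist b w := hG.dist_triangle
        rw [dist_eq_one_iff_adj.2 h] at h2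
        omega

lemma exists_closer (hG : G.Connected) {x v : V} (h : x ≠ v) :
    ∃ q, G.Adj x q ∧ G.dist q v + 1 = G.dist x v := by
  obtain ⟨p, hp⟩ := hG.exists_walk_length_eq_dist x v
  cases p with
  | nil => exact (h rfl).elim
  | @cons _ b _ ha p =>
    refine ⟨b, ha, ?_⟩
    rw [Walk.length_cons] at hp
    have := dist_le p
    have h2 : G.dist x v ≤ G.dist x b + G.dist b v := hG.dist_triangle
    rw [dist_eq_one_iff_adj.2 ha] at h2
    omega

/-- The abstract properties of the vertex set of the unique cycle. -/
structure CycSet (G : SimpleGraph V) (C : Set V) : Prop where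
  bridge : ∀ x y, x ∉ C → G.Adj x y → G.IsBridge s(x, y)
  reach : ∀ x y z z', x ∉ C → z ∈ C → z' ∈ C → (G.deleteEdges {s(x, y)}).Reachable z z'

variable {C : Set V}

lemma CycSet.bridge' (hC : CycSet G C) {x y : V} (hy : y ∉ C) (h : G.Adj x y) :
    G.IsBridge s(x, y) := by
  rw [Sym2.eq_swap]; exact hC.bridge _ _ hy h.symm

lemma CycSet.onSide (hC : CycSet G C) {w y z z' : V} (hy : y ∉ C) (hz : z ∈ C) (hz' : z' ∈ C)
    (h : OnSide G w y z') : OnSide G w y z := by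
  have := hC.reach y w z z' hy hz hz'
  rw [Sym2.eq_swap] at this
  exact this.trans h

lemma CycSet.exists_leaf [Fintype V] [DecidableRel G.Adj] (hG : G.Connected) (hC : CycSet G C)
    {w y v₀ : V} (ha : G.Adj w y) (hy : y ∉ C) (hv₀ : v₀ ∈ C) (hs : OnSide G w y v₀) :
    ∃ x, G.degree x = 1 ∧ OnSide G y w x := by
  classical
  have hb := hC.bridge' hy ha
  obtain ⟨x, hx, hmax⟩ := Finset.exists_max_image (Finset.univ.filter fun x => OnSide G y w x)
    (fun x => G.dist x w) ⟨y, by simp [onSide_self]⟩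
  simp only [Finset.mem_filter, Finset.mem_univ, true_and] at hx hmax
  have hxC : x ∉ C := fun h => onSide_not_both hb (hC.onSide hy h hv₀ hs) hx
  have hxw : x ≠ w := by
    rintro rfl
    exact onSide_not_both hb (onSide_self _ _) hx
  refine ⟨x, ?_, hx⟩
  obtain ⟨q, hq, hqd⟩ := exists_closer hG hxw
  by_contra hdeg
  have : ∃ q', G.Adj x q' ∧ q' ≠ q := by
    by_contra! hcon
    apply hdeg
    rw [← card_neighborFinset_eq_degree, Finset.card_eq_one]
    refine ⟨q, ?_⟩
    ext t
    simp only [mem_neighborFinset, Finset.mem_singleton]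
    exact ⟨hcon t, fun h => h ▸ hq⟩
  obtain ⟨q', hq', hne⟩ := this
  have hbx := hC.bridge x q' hxC hq'
  rcases onSide_or hG x q' w with h | h
  · have h1 := dist_bridge hG hq' hbx h (onSide_self _ _)
    rw [dist_self, G.dist_comm (u := w), G.dist_comm (u := w)] at h1
    have h2 := hmax q' (onSide_step hx hq'.symm ?_)
    · omega
    · intro he
      rcases Sym2.eq_iff.1 he with ⟨rfl, rfl⟩ | ⟨rfl, rfl⟩
      · exact hxw rfl
      · simp at h1
  · have hbx' := hC.bridge' hxC hq'.symm
    have h1 := dist_bridge hG hq'.symm hbx' h (onSide_self x q')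
    have hqs : OnSide G x q' q := by
      refine onSide_step (onSide_self x q') hq.symm ?_
      intro he
      rcases Sym2.eq_iff.1 he with ⟨rfl, rfl⟩ | ⟨rfl, -⟩
      · exact hq.ne rfl
      · exact hne rfl
    have h2 := dist_bridge hG hq'.symm hbx' h hqs
    have h3 := dist_eq_one_iff_adj.2 hq
    rw [dist_self] at h1
    have h5 : G.dist w x = G.dist x w := G.dist_comm
    have h4 : G.dist w q = G.dist q w := G.dist_comm
    omega

lemma CycSet.parent (hG : G.Connected) (hC : CycSet G C) {u v₀ : V} (hu : u ∉ C) (hv₀ : v₀ ∈ C) :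
    ∃ p, G.Adj p u ∧ ∀ z ∈ C, OnSide G p u z := by
  have : u ≠ v₀ := fun h => hu (h ▸ hv₀)
  obtain ⟨p, hp, hd⟩ := exists_closer hG this
  refine ⟨p, hp.symm, fun z hz => ?_⟩
  refine hC.onSide hu hz hv₀ ?_
  rcases onSide_or hG p u v₀ with h | h
  · exact h
  · have := dist_bridge hG hp (hC.bridge _ _ hu hp) h (onSide_self _ _)
    rw [dist_self, G.dist_comm (u := v₀), G.dist_comm (u := v₀)] at this
    omega

lemma CycSet.proj (hG : G.Connected) (hC : CycSet G C) {v₀ : V} (hv₀ : v₀ ∈ C) (u : V) :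
    ∃ a ∈ C, ∀ z ∈ C, G.dist u z = G.dist u a + G.dist a z := by
  induction hn : G.dist u v₀ using Nat.strong_induction_on generalizing u with
  | _ n ih =>
    by_cases hu : u ∈ C
    · exact ⟨u, hu, by simp⟩
    · obtain ⟨p, hp, hs⟩ := hC.parent hG hu hv₀
      have key : ∀ z ∈ C, G.dist u z = G.dist p z + 1 := fun z hz => by
        have := dist_bridge hG hp (hC.bridge' hu hp) (hs z hz) (onSide_self _ _)
        rw [dist_self, G.dist_comm (u := z), G.dist_comm (u := z)] at this
        exact this
      obtain ⟨a, haC, ha⟩ := ih _ (by have := key v₀ hv₀; omega) p rfl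
      refine ⟨a, haC, fun z hz => ?_⟩
      rw [key z hz, key a haC, ha z hz]; omega

/-- For `w ∈ C` with a neighbour outside `C` there is a leaf hanging at `w`. -/
lemma CycSet.hanging [Fintype V] [DecidableRel G.Adj] (hG : G.Connected) (hC : CycSet G C)
    {w y : V} (ha : G.Adj w y) (hy : y ∉ C) (hw : w ∈ C) :
    ∃ x, G.degree x = 1 ∧ ∀ u a, a ∈ C → (∀ z ∈ C, G.dist u z = G.dist u a + G.dist a z) →
      (a ≠ w ∨ u ∈ C) → G.dist u x = G.dist u a + G.dist a w + G.dist w x := by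
  obtain ⟨x, hx, hxs⟩ := hC.exists_leaf hG ha hy hw (onSide_self _ _)
  refine ⟨x, hx, fun u a haC hpr hor => ?_⟩
  have hb := hC.bridge' hy ha
  have hside : OnSide G w y u := by
    rcases hor with h | h
    · refine (onSide_or hG w y u).resolve_right fun hu => h ?_
      have h1 := dist_bridge hG ha hb (hC.onSide hy haC hw (onSide_self _ _)) hu
      have h2 := dist_bridge hG ha hb (onSide_self _ _) hu
      have h3 := hpr w hw
      rw [dist_self] at h2
      rw [G.dist_comm (u := a) (v := u)] at h1
      rw [G.dist_comm (u := w) (v := u)] at h2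
      exact hG.dist_eq_zero_iff.1 (by omega)
    · exact hC.onSide hy h hw (onSide_self _ _)
  have h1 := dist_bridge hG ha hb hside hxs
  have h2 := dist_bridge hG ha hb (onSide_self _ _) hxs
  have h3 := hpr w hw
  rw [dist_self] at h2
  omega

/-- Two vertices not both on the cycle are resolved by leaves. -/
lemma CycSet.resolve_off [Fintype V] [DecidableRel G.Adj] (hG : G.Connected) (hC : CycSet G C)
    {v₀ : V} (hv₀ : v₀ ∈ C) (hW : ∀ a ∈ C, ∃ w ∈ C, w ≠ a ∧ ∃ y, G.Adj w y ∧ y ∉ C)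
    {u v : V} (huv : u ≠ v) (hu : u ∉ C)
    (f : ∀ x y, G.degree x = 1 → G.degree y = 1 →
      (G.dist u x : ℤ) - (G.dist v x : ℤ) = (G.dist u y : ℤ) - (G.dist v y : ℤ)) : False := by
  have hpos := hG.pos_dist_of_ne huv
  have hsym : G.dist v u = G.dist u v := G.dist_comm
  -- good lemma
  have good : ∀ s t p : V, s ∉ C → G.Adj p s → (∀ z ∈ C, OnSide G p s z) → OnSide G p s t →
      ∃ x, G.degree x = 1 ∧ G.dist t x = G.dist t s + G.dist s x := by
    intro s t p hs hp hz ht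
    obtain ⟨x, hx, hxs⟩ := hC.exists_leaf hG hp hs hv₀ (hz _ hv₀)
    refine ⟨x, hx, ?_⟩
    have h1 := dist_bridge hG hp (hC.bridge' hs hp) ht hxs
    have h2 := dist_bridge hG hp (hC.bridge' hs hp) ht (onSide_self _ _)
    rw [dist_self] at h2
    omega
  -- if `t` is below `s`, a hanging leaf sees `t` through `s`
  have below : ∀ s t p : V, s ∉ C → G.Adj p s → (∀ z ∈ C, OnSide G p s z) → OnSide G s p t →
      (∀ z ∈ C, G.dist t z = G.dist t s + G.dist s z) ∧
      ∃ x, G.degree x = 1 ∧ G.dist t x = G.dist t s + G.dist s x := by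
    intro s t p hs hp hz ht
    have k : ∀ z ∈ C, G.dist t z = G.dist t s + G.dist s z := by
      intro z hzC
      have h1 := dist_bridge hG hp.symm (hC.bridge s p hs hp.symm) ht (hz z hzC)
      have h2 := dist_bridge hG hp.symm (hC.bridge s p hs hp.symm) (onSide_self _ _) (hz z hzC)
      rw [dist_self] at h2
      omega
    refine ⟨k, ?_⟩
    obtain ⟨a, haC, ha⟩ := hC.proj hG hv₀ s
    obtain ⟨w, hwC, hwa, y, hy, hyC⟩ := hW a haC
    obtain ⟨x, hx, h⟩ := hC.hanging hG hy hyC hwC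
    have h1 := h s a haC ha (Or.inl hwa.symm)
    have h2 := h t a haC (fun z hz => by have := k z hz; have := k a haC; have := ha z hz; omega)
      (Or.inl hwa.symm)
    refine ⟨x, hx, ?_⟩
    have := k a haC
    omega
  obtain ⟨p, hp, hps⟩ := hC.parent hG hu hv₀
  by_cases hv : v ∈ C
  · obtain ⟨x, hx, hxd⟩ := good u v p hu hp hps (hps v hv)
    obtain ⟨a, haC, ha⟩ := hC.proj hG hv₀ u
    obtain ⟨w, hwC, hwa, y, hy, hyC⟩ := hW a haC
    obtain ⟨x', hx', h⟩ := hC.hanging hG hy hyC hwC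
    have h1 := h u a haC ha (Or.inl hwa.symm)
    have h2 := h v v hv (by simp) (Or.inr hv)
    have h3 := f x x' hx hx'
    have h4 := ha v hv
    have h5 : G.dist v w ≤ G.dist v a + G.dist a w := hG.dist_triangle
    have h6 : G.dist v a = G.dist a v := G.dist_comm
    have h7 : 0 < G.dist u a := hG.pos_dist_of_ne (fun h => hu (h ▸ haC))
    rw [dist_self] at h2
    omega
  · obtain ⟨q, hq, hqs⟩ := hC.parent hG hv hv₀
    have A : ∃ x, G.degree x = 1 ∧ G.dist v x = G.dist v u + G.dist u x := by
      rcases onSide_or hG p u v with h | h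
      · exact good u v p hu hp hps h
      · exact (below u v p hu hp hps h).2
    have B : ∃ x, G.degree x = 1 ∧ G.dist u x = G.dist u v + G.dist v x := by
      rcases onSide_or hG q v u with h | h
      · exact good v u q hv hq hqs h
      · exact (below v u q hv hq hqs h).2
    obtain ⟨x, hx, h1⟩ := A
    obtain ⟨y, hy, h2⟩ := B
    have := f x y hx hy
    omega

end aux

section cyc
variable {V : Type*} [DecidableEq V] {G : SimpleGraph V}

lemma cycle_card {u : V} {c : G.Walk u u} (hc : c.IsCycle) :
    c.support.toFinset.card = c.length := by
  have h1 : c.support.toFinset = c.support.tail.toFinset := by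
    ext t
    simp only [List.mem_toFinset]
    refine ⟨fun h => ?_, fun h => List.mem_of_mem_tail h⟩
    rw [Walk.mem_support_iff] at h
    rcases h with rfl | h
    · exact Walk.end_mem_tail_support hc.not_nil
    · exact h
  rw [h1, List.toFinset_card_of_nodup hc.support_nodup]
  simp

variable {v₀ : V} {c : G.Walk v₀ v₀}

lemma no_chord (hc : c.IsCycle)
    (huniq : ∀ (u : V) (c' : G.Walk u u), c'.IsCycle →
      c'.support.toFinset = c.support.toFinset) {w y : V} (hw : w ∈ c.support)
    (hy : y ∈ c.support) (h : G.Adj w y) : s(w, y) ∈ c.edges := by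
  by_contra hne
  set r := c.rotate w hw with hr
  have hrc : r.IsCycle := hc.rotate hw
  have hre : s(w, y) ∉ r.edges := by
    rwa [(c.rotate_edges w hw).mem_iff]
  have hyr : y ∈ r.support := by
    have := huniq _ r hrc
    have h2 : y ∈ r.support.toFinset := by rw [this]; simpa using hy
    simpa using h2
  have hP := hrc.isPath_takeUntil hyr
  have hPe : s(y, w) ∉ (r.takeUntil y hyr).edges := by
    rw [Sym2.eq_swap]
    exact fun h' => hre (Walk.edges_takeUntil_subset_edges _ _ h')
  have hcy : (Walk.cons h.symm (r.takeUntil y hyr)).IsCycle :=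
    (Walk.cons_isCycle_iff _ _).2 ⟨hP, hPe⟩
  have e1 := cycle_card hcy
  have e2 := cycle_card hrc
  rw [huniq _ _ hcy] at e1
  rw [huniq _ _ hrc] at e2
  rw [Walk.length_cons] at e1
  have e3 := congrArg Walk.length (r.take_spec hyr)
  rw [Walk.length_append] at e3
  have e4 : (r.dropUntil y hyr).length = 1 := by omega
  apply hre
  apply Walk.edges_dropUntil_subset_edges _ hyr
  generalize r.dropUntil y hyr = d at e4
  cases d with
  | nil => simp at e4
  | cons a d =>
    cases d with
    | nil => simp [Sym2.eq_swap]
    | cons _ _ => simp at e4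

lemma cycSet (hc : c.IsCycle)
    (huniq : ∀ (u : V) (c' : G.Walk u u), c'.IsCycle →
      c'.support.toFinset = c.support.toFinset) : CycSet G {x | x ∈ c.support} where
  bridge x y hx hxy := by
    rw [isBridge_iff_forall_cycle_notMem hxy]
    intro u p hp he
    apply hx
    have h2 : x ∈ p.support.toFinset := by simpa using Walk.fst_mem_support_of_mem_edges _ he
    rw [huniq u p hp] at h2
    simpa using h2
  reach x y z z' hx hz hz' := by
    have key : ∀ z ∈ c.support, (G.deleteEdges {s(x, y)}).Reachable v₀ z := by
      intro z hz
      refine ⟨(c.takeUntil z hz).toDeleteEdges _ ?_⟩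
      intro e he he'
      rw [Set.mem_singleton_iff] at he'
      subst he'
      exact hx (Walk.fst_mem_support_of_mem_edges _ (Walk.edges_takeUntil_subset_edges _ _ he))
    exact (key z hz).symm.trans (key z' hz')

lemma coe_dist (hG : G.Connected) (hc : c.IsCycle)
    (huniq : ∀ (u : V) (c' : G.Walk u u), c'.IsCycle →
      c'.support.toFinset = c.support.toFinset) (z z' : c.toSubgraph.verts) :
    c.toSubgraph.coe.dist z z' = G.dist (z : V) z' := by
  have hC := cycSet hc huniq
  have key : ∀ n, ∀ z : c.toSubgraph.verts, G.dist (z : V) z' = n →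
      ∃ p : c.toSubgraph.coe.Walk z z', p.length = n := by
    intro n
    induction n with
    | zero =>
      intro z hz
      have : z = z' := Subtype.ext (hG.dist_eq_zero_iff.1 hz)
      subst this
      exact ⟨Walk.nil, rfl⟩
    | succ n ih =>
      intro z hz
      have hne : (z : V) ≠ z' := by
        intro h
        rw [h, dist_self] at hz
        omega
      obtain ⟨q, hq, hqd⟩ := exists_closer hG hne
      have hzC : (z : V) ∈ c.support := c.mem_verts_toSubgraph.1 z.2
      have hzC' : (z' : V) ∈ c.support := c.mem_verts_toSubgraph.1 z'.2
      by_cases hqC : q ∈ c.support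
      · obtain ⟨p, hp⟩ := ih ⟨q, c.mem_verts_toSubgraph.2 hqC⟩ (by simp only; omega)
        have hadj : c.toSubgraph.coe.Adj z ⟨q, c.mem_verts_toSubgraph.2 hqC⟩ := by
          rw [Subgraph.coe_adj, Walk.adj_toSubgraph_iff_mem_edges]
          exact no_chord hc huniq hzC hqC hq
        exact ⟨Walk.cons hadj p, by simp [hp]⟩
      · exfalso
        have := dist_bridge hG hq (hC.bridge' hqC hq)
          (hC.onSide hqC hzC' hzC (onSide_self _ _)) (onSide_self _ _)
        rw [dist_self, G.dist_comm (u := (z' : V)), G.dist_comm (u := (z' : V))] at this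
        omega
  obtain ⟨p, hp⟩ := key _ z rfl
  apply le_antisymm
  · rw [← hp]; exact dist_le p
  · obtain ⟨q, hq⟩ := (Walk.reachable p).exists_walk_length_eq_dist
    rw [← hq]
    have := dist_le (q.map c.toSubgraph.hom)
    rw [Walk.length_map] at this
    exact this

lemma exists_off [Fintype V] [DecidableRel G.Adj] (hc : c.IsCycle)
    (huniq : ∀ (u : V) (c' : G.Walk u u), c'.IsCycle →
      c'.support.toFinset = c.support.toFinset) {w : V} (hw : w ∈ c.support)
    (hd : 3 ≤ G.degree w) : ∃ y, G.Adj w y ∧ y ∉ c.support := by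
  by_contra! hcon
  have h2 := hc.ncard_neighborSet_toSubgraph_eq_two hw
  have h3 : c.toSubgraph.neighborSet w = G.neighborSet w := by
    ext y
    simp only [Subgraph.mem_neighborSet, mem_neighborSet]
    refine ⟨fun h => h.adj_sub, fun h => ?_⟩
    rw [Walk.adj_toSubgraph_iff_mem_edges]
    exact no_chord hc huniq hw (hcon y h) h
  rw [h3, ← coe_neighborFinset, Set.ncard_coe_finset, card_neighborFinset_eq_degree] at h2
  omega

end cyc

lemma leaf_mem {V : Type*} [Fintype V] (G : SimpleGraph V) [DecidableRel G.Adj]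
    (hG : G.Connected) (W : Set V) (hW : IsDoublyResolvingSet G W) (l : V)
    (hl : G.degree l = 1) : l ∈ W := by
  by_contra hlW
  rw [← card_neighborFinset_eq_degree, Finset.card_eq_one] at hl
  obtain ⟨p, hp⟩ := hl
  have hadj : ∀ q, G.Adj l q ↔ q = p := fun q => by
    rw [← mem_neighborFinset, hp, Finset.mem_singleton]
  have key : ∀ x ∈ W, G.dist p x + 1 = G.dist l x := by
    intro x hx
    obtain ⟨q, hq, hd⟩ := exists_closer hG (x := l) (v := x) (fun h => hlW (h ▸ hx))
    rw [(hadj q).1 hq] at hd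
    exact hd
  obtain ⟨x, hx, y, hy, h⟩ := hW l p ((hadj p).2 rfl).ne
  apply h
  have h1 := key x hx
  have h2 := key y hy
  omega

/-- Let `G` be a connected unicyclic graph with unique cycle `c`, and let `W` be a
doubly resolving set for the cycle (as a graph in its own right). If every vertex
of `W` has degree at least `3` in `G`, then the set of leaves of `G` is a doubly
resolving set for `G` of minimum cardinality (a doubly basis of `G`). -/
theorem stmt_12 {V : Type*} [Fintype V] [DecidableEq V] (G : SimpleGraph V)
    [DecidableRel G.Adj] (hG : G.Connected)
    (v₀ : V) (c : G.Walk v₀ v₀) (hc : c.IsCycle)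
    (huniq : ∀ (u : V) (c' : G.Walk u u), c'.IsCycle →
      c'.support.toFinset = c.support.toFinset)
    (W : Set ↑c.toSubgraph.verts) (hW : IsDoublyResolvingSet c.toSubgraph.coe W)
    (hdeg : ∀ x ∈ W, 3 ≤ G.degree (x : V)) :
    IsDoublyResolvingSet G ↑(Finset.univ.filter fun v : V => G.degree v = 1) ∧
      (Finset.univ.filter fun v : V => G.degree v = 1).card = psi G := by
  have main : IsDoublyResolvingSet G ↑(Finset.univ.filter fun v : V => G.degree v = 1) := by
    have hC := cycSet hc huniq
    have hv₀ : v₀ ∈ {x | x ∈ c.support} := c.start_mem_support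
    have hoff : ∀ w ∈ W, ∃ y, G.Adj (w : V) y ∧ y ∉ {x | x ∈ c.support} := fun w hw =>
      exists_off hc huniq (c.mem_verts_toSubgraph.1 w.2) (hdeg w hw)
    have hW2 : ∀ a ∈ {x | x ∈ c.support}, ∃ w ∈ {x | x ∈ c.support}, w ≠ a ∧
        ∃ y, G.Adj w y ∧ y ∉ {x | x ∈ c.support} := by
      intro a ha
      by_contra! hcon
      have hall : ∀ w ∈ W, (w : V) = a := by
        intro w hw
        by_contra hwa
        obtain ⟨y, hy, hyC⟩ := hoff w hw
        exact hyC (hcon w (c.mem_verts_toSubgraph.1 w.2) hwa y hy)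
      obtain ⟨x, hx, y, hy, h⟩ := hW ⟨v₀, c.mem_verts_toSubgraph.2 hv₀⟩
        ⟨c.snd, c.mem_verts_toSubgraph.2 (c.getVert_mem_support 1)⟩
        (fun h => (c.adj_snd hc.not_nil).ne (congrArg Subtype.val h))
      have : x = y := Subtype.ext ((hall x hx).trans (hall y hy).symm)
      subst this
      exact h rfl
    intro u v huv
    by_contra! hcon
    have f : ∀ x y, G.degree x = 1 → G.degree y = 1 →
        (G.dist u x : ℤ) - (G.dist v x : ℤ) = (G.dist u y : ℤ) - (G.dist v y : ℤ) := by
      intro x y hx hy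
      have := hcon x (by simpa using hx) y (by simpa using hy)
      unfold doublyResolves at this
      push Not at this
      exact this
    by_cases hu : u ∈ {x | x ∈ c.support}
    · by_cases hv : v ∈ {x | x ∈ c.support}
      · obtain ⟨x, hx, y, hy, h⟩ := hW ⟨u, c.mem_verts_toSubgraph.2 hu⟩
          ⟨v, c.mem_verts_toSubgraph.2 hv⟩ (fun h => huv (congrArg Subtype.val h))
        unfold doublyResolves at h
        simp only [coe_dist hG hc huniq] at h
        apply h
        have red : ∀ w ∈ W, ∃ l, G.degree l = 1 ∧
            (G.dist u l : ℤ) - G.dist v l = (G.dist u w : ℤ) - G.dist v w := by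
          intro w hw
          obtain ⟨t, ht, htC⟩ := hoff w hw
          obtain ⟨l, hl, hl'⟩ := hC.hanging hG ht htC (c.mem_verts_toSubgraph.1 w.2)
          refine ⟨l, hl, ?_⟩
          have h1 := hl' u u hu (by simp) (Or.inr hu)
          have h2 := hl' v v hv (by simp) (Or.inr hv)
          rw [dist_self] at h1 h2
          omega
        obtain ⟨l, hl, e1⟩ := red x hx
        obtain ⟨m, hm, e2⟩ := red y hy
        rw [← e1, ← e2]
        exact f l m hl hm
      · exact hC.resolve_off hG hv₀ hW2 huv.symm hv (fun x y hx hy => by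
          have := f x y hx hy
          omega)
    · exact hC.resolve_off hG hv₀ hW2 huv hu f
  refine ⟨main, le_antisymm ?_ (Nat.sInf_le ⟨_, rfl, main⟩)⟩
  refine le_csInf ⟨_, _, rfl, main⟩ ?_
  rintro k ⟨W', rfl, hW'⟩
  apply Finset.card_le_card
  intro l hl
  have := leaf_mem G hG _ hW' l (by simpa using hl)
  simpa using this
end

section
/- Let G be a finite simple connected unicyclic graph that is not a cycle, and let m be the length of its unique cycle C(G). Then l(G) ≤ ψ(G), and ψ(G) ≤ l(G) + 1 if m is odd, while ψ(G) ≤ l(G) + 2 if m is even. -/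
open SimpleGraph

namespace Unicyc

variable {V : Type*} {G : SimpleGraph V}

lemma cycle_card [DecidableEq V] {u : V} {c : G.Walk u u} (hc : c.IsCycle) :
    c.support.toFinset.card = c.length := by
  have h1 : c.support.toFinset = c.support.tail.toFinset := by
    ext x
    simp only [List.mem_toFinset]
    constructor
    · intro hx
      rcases (c.mem_support_iff).1 hx with h | h
      · subst h
        exact c.end_mem_tail_support hc.not_nil
      · exact h
    · exact List.mem_of_mem_tail
  rw [h1, List.toFinset_card_of_nodup hc.support_nodup]
  simp

lemma no_chord [DecidableEq V] {v₀ : V} {c : G.Walk v₀ v₀} (hc : c.IsCycle)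
    (huniq : ∀ (u : V) (c' : G.Walk u u), c'.IsCycle →
      c'.support.toFinset = c.support.toFinset) {a b : V} (ha : a ∈ c.support)
    (hb : b ∈ c.support) (hab : G.Adj a b) : s(a, b) ∈ c.edges := by
  by_contra hne
  have hcr : (c.rotate a ha).IsCycle := by simpa using hc
  have hb' : b ∈ (c.rotate a ha).support := by simpa using hb
  have hE : ∀ e, e ∈ (c.rotate a ha).edges ↔ e ∈ c.edges := fun e =>
    (c.rotate_edges a ha).perm.mem_iff
  have hlen : (c.rotate a ha).length = c.length := by simp
  generalize c.rotate a ha = c1 at hcr hb' hE hlen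
  have ht := hcr.isPath_takeUntil hb'
  have hcyc : (Walk.cons hab.symm (c1.takeUntil b hb')).IsCycle := by
    rw [Walk.cons_isCycle_iff]
    refine ⟨ht, fun h => hne ?_⟩
    rw [Sym2.eq_swap]
    exact (hE _).1 (c1.edges_takeUntil_subset_edges hb' h)
  have h1 := cycle_card hcyc
  rw [huniq _ _ hcyc, cycle_card hc] at h1
  have h2 := congrArg Walk.length (c1.take_spec hb')
  rw [Walk.length_append] at h2
  rw [Walk.length_cons] at h1
  have h3 : (c1.dropUntil b hb').length = 1 := by omega
  apply hne
  rw [← hE, Sym2.eq_swap]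
  apply c1.edges_dropUntil_subset_edges hb'
  rw [Walk.mk_mem_edges_iff_exists]
  refine ⟨0, by omega, ?_⟩
  have : (c1.dropUntil b hb').getVert 1 = a := by
    rw [← h3, Walk.getVert_length]
  simp [this]

lemma bridge [DecidableEq V] {v₀ : V} {c : G.Walk v₀ v₀} (hc : c.IsCycle)
    (huniq : ∀ (u : V) (c' : G.Walk u u), c'.IsCycle →
      c'.support.toFinset = c.support.toFinset) {a b : V}
    (hab : G.Adj a b) (hne : s(a, b) ∉ c.edges) : G.IsBridge s(a, b) := by
  rw [isBridge_iff_forall_cycle_notMem (by simpa using hab)]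
  intro u p hp hmem
  have h := huniq u p hp
  have h' : ∀ x, x ∈ p.support → x ∈ c.support := fun x hx => by
    rw [← List.mem_toFinset, ← h, List.mem_toFinset]; exact hx
  exact hne (no_chord hc huniq (h' _ (p.fst_mem_support_of_mem_edges hmem))
    (h' _ (p.snd_mem_support_of_mem_edges hmem)) hab)

/-- The forest obtained by deleting the cycle edges. -/
def forest {v₀ : V} (c : G.Walk v₀ v₀) : SimpleGraph V := G.deleteEdges {e | e ∈ c.edges}

lemma forest_adj {v₀ : V} (c : G.Walk v₀ v₀) {a b : V} :
    (forest c).Adj a b ↔ G.Adj a b ∧ s(a, b) ∉ c.edges := by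
  simp [forest]

lemma forest_le {v₀ : V} (c : G.Walk v₀ v₀) : forest c ≤ G := deleteEdges_le _

lemma forest_acyclic [DecidableEq V] {v₀ : V} {c : G.Walk v₀ v₀} (hc : c.IsCycle)
    (huniq : ∀ (u : V) (c' : G.Walk u u), c'.IsCycle →
      c'.support.toFinset = c.support.toFinset) : (forest c).IsAcyclic := by
  rw [isAcyclic_iff_forall_adj_isBridge]
  intro a b hab
  rw [forest_adj] at hab
  exact (bridge hc huniq hab.1 hab.2).anti (forest_le c)

lemma reach_unique [DecidableEq V] {v₀ : V} {c : G.Walk v₀ v₀} (hc : c.IsCycle)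
    (huniq : ∀ (u : V) (c' : G.Walk u u), c'.IsCycle →
      c'.support.toFinset = c.support.toFinset) {a b : V} (ha : a ∈ c.support)
    (hb : b ∈ c.support) (hab : (forest c).Reachable a b) : a = b := by
  by_contra hne
  obtain ⟨p, hp⟩ := hab.exists_isPath
  cases p with
  | nil => exact hne rfl
  | @cons _ x _ h q =>
    rw [Walk.cons_isPath_iff] at hp
    have hadj := (forest_adj c).1 h
    have hbr := bridge hc huniq hadj.1 hadj.2
    rw [isBridge_iff_forall_walk_mem_edges] at hbr
    have hcr : b ∈ (c.rotate a ha).support := by simpa using hb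
    have hE : ∀ e, e ∈ (c.rotate a ha).edges ↔ e ∈ c.edges := fun e =>
      (c.rotate_edges a ha).perm.mem_iff
    have := hbr (((c.rotate a ha).takeUntil b hcr).append (q.mapLe (forest_le c)).reverse)
    rw [Walk.edges_append, List.mem_append] at this
    rcases this with h1 | h1
    · exact hadj.2 ((hE _).1 (Walk.edges_takeUntil_subset_edges _ hcr h1))
    · simp only [Walk.edges_reverse, List.mem_reverse, Walk.edges_mapLe_eq_edges] at h1
      exact hp.2 (q.fst_mem_support_of_mem_edges h1)

lemma exists_root {v₀ : V} (c : G.Walk v₀ v₀) (hc : c.IsCycle) (hG : G.Connected) (v : V) :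
    ∃ i < c.length, (forest c).Reachable v (c.getVert i) := by
  have key : ∀ x ∈ c.support, ∃ i < c.length, (forest c).Reachable x (c.getVert i) := by
    intro x hx
    obtain ⟨n, hn, hle⟩ := Walk.mem_support_iff_exists_getVert.1 hx
    have := hc.three_le_length
    rcases hle.lt_or_eq with h | h
    · exact ⟨n, h, hn ▸ Reachable.refl _⟩
    · refine ⟨0, by omega, ?_⟩
      subst h
      rw [Walk.getVert_length] at hn
      subst hn
      simp
  obtain ⟨p⟩ := hG v v₀
  induction p with
  | nil => exact key _ c.start_mem_support
  | @cons x y _ h q ih =>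
    by_cases he : s(x, y) ∈ c.edges
    · exact key _ (c.fst_mem_support_of_mem_edges he)
    · obtain ⟨i, hi, hr⟩ := ih c hc key
      exact ⟨i, hi, ((forest_adj c).2 ⟨h, he⟩).reachable.trans hr⟩

/-- In a finite forest, geodesics extend to leaves. -/
lemma extend [Fintype V] {H : SimpleGraph V} (hH : H.IsAcyclic) {u v : V} (huv : u ≠ v)
    (hr : H.Reachable v u) : ∃ x y, H.Reachable v x ∧ H.dist v x = H.dist v u + H.dist u x ∧
      H.Adj x y ∧ ∀ z, H.Adj x z → z = y := by
  classical
  let S : Finset V := Finset.univ.filter fun x =>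
    H.Reachable v x ∧ H.dist v x = H.dist v u + H.dist u x
  have hS : S.Nonempty := ⟨u, by simp [S, hr]⟩
  obtain ⟨x, hxS, hmax⟩ := S.exists_max_image (fun x => H.dist v x) hS
  simp only [S, Finset.mem_filter, Finset.mem_univ, true_and] at hxS hmax
  obtain ⟨hvx, hd⟩ := hxS
  obtain ⟨p, hp, hpl⟩ := hvx.exists_path_of_dist
  have hpos := hr.pos_dist_of_ne huv.symm
  have hpn : ¬ p.Nil := by
    rw [Walk.not_nil_iff_lt_length]; omega
  refine ⟨x, p.penultimate, hvx, hd, (p.adj_penultimate hpn).symm, fun z hz => ?_⟩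
  apply hH.eq_penultimate_of_adj_end hp hz
  by_contra hzp
  have hq := hp.concat hzp hz
  obtain ⟨q, hq1, hq2⟩ := (hvx.trans hz.reachable).exists_path_of_dist
  have := (hH.subsingleton_path v z).elim ⟨q, hq1⟩ ⟨_, hq⟩
  have h3 : q = p.concat hz := congrArg Subtype.val this
  have h4 : H.dist v z = H.dist v x + 1 := by
    rw [← hq2, h3, Walk.length_concat, hpl]
  have hux : H.Reachable u x := hr.symm.trans hvx
  have h5 := hux.dist_triangle_left z
  have h5' : H.dist x z = 1 := dist_eq_one_iff_adj.2 hz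
  have h6 := hr.dist_triangle_left z
  have := hmax z ⟨hvx.trans hz.reachable, by omega⟩
  omega

/-- Distance in the cycle of length `m`. -/
def cyc (m i j : ℕ) : ℕ := min ((i - j) + (j - i)) (m - ((i - j) + (j - i)))

lemma cyc_self (m i : ℕ) : cyc m i i = 0 := by
  simp [cyc]

lemma cyc_tri {m i j k : ℕ} (hi : i < m) (hj : j < m) (hk : k < m) :
    cyc m i k ≤ cyc m i j + cyc m j k := by
  unfold cyc
  omega

lemma dist_getVert_le {u v : V} (hG : G.Connected) (p : G.Walk u v) (i n : ℕ)
    (hn : i + n ≤ p.length) : G.dist (p.getVert i) (p.getVert (i + n)) ≤ n := by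
  induction n with
  | zero => simp
  | succ n ih =>
    have h1 := ih (by omega)
    have h2 : G.Adj (p.getVert (i + n)) (p.getVert (i + n + 1)) :=
      p.adj_getVert_succ (by omega)
    have h3 := dist_eq_one_iff_adj.2 h2
    have h4 := hG.dist_triangle (u := p.getVert i) (v := p.getVert (i + n))
      (w := p.getVert (i + n + 1))
    rw [← add_assoc]
    omega

lemma dist_cyc_le' {v₀ : V} (hG : G.Connected) (c : G.Walk v₀ v₀) {i j : ℕ}
    (hij : i ≤ j) (hj : j < c.length) :
    G.dist (c.getVert i) (c.getVert j) ≤ cyc c.length i j := by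
  have h1 := dist_getVert_le hG c i (j - i) (by omega)
  have h2 := dist_getVert_le hG c 0 i (by omega)
  have h3 := dist_getVert_le hG c j (c.length - j) (by omega)
  rw [show i + (j - i) = j by omega] at h1
  rw [show j + (c.length - j) = c.length by omega, Walk.getVert_length] at h3
  rw [zero_add, Walk.getVert_zero] at h2
  have h4 := hG.dist_triangle (u := c.getVert j) (v := v₀) (w := c.getVert i)
  rw [dist_comm (u := c.getVert j) (v := c.getVert i)] at h4
  unfold cyc
  omega

lemma dist_cyc_le {v₀ : V} (hG : G.Connected) (c : G.Walk v₀ v₀) {i j : ℕ}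
    (hi : i < c.length) (hj : j < c.length) :
    G.dist (c.getVert i) (c.getVert j) ≤ cyc c.length i j := by
  rcases le_total i j with h | h
  · exact dist_cyc_le' hG c h hj
  · have := dist_cyc_le' hG c h hi
    rw [dist_comm]
    unfold cyc at *
    omega

theorem structure_thm [DecidableEq V] (hG : G.Connected) {v₀ : V} {c : G.Walk v₀ v₀}
    (hc : c.IsCycle)
    (huniq : ∀ (u : V) (c' : G.Walk u u), c'.IsCycle →
      c'.support.toFinset = c.support.toFinset) :
    ∃ idx : V → ℕ, (∀ v, idx v < c.length) ∧ (∀ i < c.length, idx (c.getVert i) = i) ∧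
      (∀ u v, idx u = idx v ↔ (forest c).Reachable u v) ∧
      (∀ u v, idx u = idx v → (forest c).dist u v = G.dist u v) ∧
      (∀ u v, idx u ≠ idx v → G.dist u v = G.dist u (c.getVert (idx u)) +
        cyc c.length (idx u) (idx v) + G.dist (c.getVert (idx v)) v) := by
  have hm := hc.three_le_length
  choose idx hlt hreach using exists_root c hc hG
  have huq : ∀ v i, i < c.length → (forest c).Reachable v (c.getVert i) → idx v = i := by
    intro v i hi hr
    have h1 := reach_unique hc huniq (c.getVert_mem_support _) (c.getVert_mem_support _)
      ((hreach v).symm.trans hr)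
    have := hlt v
    exact hc.getVert_injOn' (by simp; omega) (by simp; omega) h1
  have hroot : ∀ i < c.length, idx (c.getVert i) = i := fun i hi => huq _ i hi (Reachable.refl _)
  have hiff : ∀ u v, idx u = idx v ↔ (forest c).Reachable u v := by
    intro u v
    constructor
    · intro h
      exact (hreach u).trans (h ▸ (hreach v).symm)
    · intro h
      exact huq _ _ (hlt v) (h.trans (hreach v))
  -- cycle edges
  have hedge : ∀ a b, s(a, b) ∈ c.edges → c.getVert (idx a) = a ∧ c.getVert (idx b) = b ∧
      (idx b = idx a + 1 ∨ idx a = idx b + 1 ∨ (idx a = 0 ∧ idx b + 1 = c.length) ∨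
        (idx b = 0 ∧ idx a + 1 = c.length)) := by
    have hstep : ∀ i < c.length, c.getVert (idx (c.getVert i)) = c.getVert i ∧
        c.getVert (idx (c.getVert (i+1))) = c.getVert (i+1) ∧
        idx (c.getVert i) = i ∧ (idx (c.getVert (i+1)) = i + 1 ∨
          (idx (c.getVert (i+1)) = 0 ∧ i + 1 = c.length)) := by
      intro i hi
      rw [hroot i hi]
      rcases Nat.lt_or_ge (i+1) c.length with h | h
      · rw [hroot _ h]; simp
      · have h' : i + 1 = c.length := by omega
        have h0 : idx v₀ = 0 := by simpa using hroot 0 (by omega)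
        rw [h', Walk.getVert_length, h0]
        simp
    intro a b hab
    obtain ⟨i, hi, he⟩ := c.mk_mem_edges_iff_exists.1 hab
    have := hstep i hi
    rcases Sym2.eq_iff.1 he with ⟨rfl, rfl⟩ | ⟨rfl, rfl⟩
    · refine ⟨this.1, this.2.1, ?_⟩
      omega
    · refine ⟨this.2.1, this.1, ?_⟩
      omega
  let H := forest c
  let D : V → V → ℕ := fun u v => if idx u = idx v then H.dist u v else
    H.dist u (c.getVert (idx u)) + cyc c.length (idx u) (idx v) + H.dist (c.getVert (idx v)) v
  have hlip : ∀ u a b, G.Adj a b → D u b ≤ D u a + 1 := by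
    intro u a b hab
    by_cases he : s(a, b) ∈ c.edges
    · obtain ⟨h1, h2, h3⟩ := hedge a b he
      have hla := hlt a
      have hlb := hlt b
      have hlu := hlt u
      simp only [D]
      rw [h1, h2]
      by_cases hua : idx u = idx a
      · by_cases hub : idx u = idx b
        · omega
        · rw [if_pos hua, if_neg hub, hua, h1]
          simp only [dist_self, cyc]
          omega
      · by_cases hub : idx u = idx b
        · rw [if_neg hua, if_pos hub, hub, h2]
          simp only [dist_self, cyc]
          omega
        · rw [if_neg hua, if_neg hub]
          simp only [dist_self, cyc]
          omega
    · have hH : H.Adj a b := (forest_adj c).2 ⟨hab, he⟩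
      have hi : idx a = idx b := (hiff _ _).2 hH.reachable
      have h1 : H.dist a b = 1 := dist_eq_one_iff_adj.2 hH
      have h2 := hH.reachable.dist_triangle_right u
      have h3 := hH.reachable.dist_triangle_right (c.getVert (idx b))
      simp only [D]
      rw [hi]
      split_ifs <;> omega
  have hlow : ∀ u v, D u v ≤ G.dist u v := by
    intro u v
    obtain ⟨p, hp⟩ := hG.exists_walk_length_eq_dist u v
    rw [← hp]
    have : ∀ a b (q : G.Walk a b), D u b ≤ D u a + q.length := by
      intro a b q
      induction q with
      | nil => simp
      | cons h q ih =>
        have := hlip u _ _ h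
        rw [Walk.length_cons]
        omega
    have h := this _ _ p
    have h0 : D u u = 0 := by simp [D]
    omega
  have hHG : ∀ u v, idx u = idx v → G.dist u v ≤ H.dist u v := fun u v h =>
    ((hiff u v).1 h).dist_anti (forest_le c)
  refine ⟨idx, hlt, hroot, hiff, ?_, ?_⟩
  · intro u v h
    have h1 := hlow u v
    simp only [D, if_pos h] at h1
    exact le_antisymm h1 (hHG u v h)
  · intro u v h
    have h1 := hlow u v
    simp only [D, if_neg h] at h1
    have h2 := hHG u (c.getVert (idx u)) (hroot _ (hlt u)).symm
    have h3 := hHG (c.getVert (idx v)) v (hroot _ (hlt v))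
    have h4 := dist_cyc_le hG c (hlt u) (hlt v)
    have h5 := hG.dist_triangle (u := u) (v := c.getVert (idx u)) (w := v)
    have h6 := hG.dist_triangle (u := c.getVert (idx u)) (v := c.getVert (idx v)) (w := v)
    omega

lemma extendG [Fintype V] [DecidableEq V] [DecidableRel G.Adj]
    {v₀ : V} {c : G.Walk v₀ v₀}
    (hc : c.IsCycle)
    (huniq : ∀ (u : V) (c' : G.Walk u u), c'.IsCycle →
      c'.support.toFinset = c.support.toFinset) {idx : V → ℕ}
    (hlt : ∀ v, idx v < c.length)
    (hroot : ∀ i < c.length, idx (c.getVert i) = i)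
    (hiff : ∀ u v, idx u = idx v ↔ (forest c).Reachable u v)
    (hdist : ∀ u v, idx u = idx v → (forest c).dist u v = G.dist u v)
    {u v : V} (huv : u ≠ v) (hi : idx u = idx v) :
    ∃ x, idx x = idx u ∧ G.dist v x = G.dist v u + G.dist u x ∧
      (x = c.getVert (idx u) ∨ G.degree x = 1) := by
  obtain ⟨x, y, hx, hd, hxy, hz⟩ := extend (forest_acyclic hc huniq) huv ((hiff _ _).1 hi.symm)
  have hvx := (hiff v x).2 hx
  refine ⟨x, by omega, ?_, ?_⟩
  · rw [hdist _ _ hvx, hdist _ _ hi.symm, hdist _ _ (hi.trans hvx)] at hd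
    exact hd
  · by_cases hxc : x ∈ c.support
    · left
      apply reach_unique hc huniq hxc (c.getVert_mem_support _)
      rw [← hiff, hroot _ (hlt u)]
      omega
    · right
      rw [degree_eq_one_iff_existsUnique_adj]
      refine ⟨y, ((forest_adj c).1 hxy).1, fun z hxz => hz z ?_⟩
      exact (forest_adj c).2 ⟨hxz, fun he => hxc (c.fst_mem_support_of_mem_edges he)⟩

theorem main_resolve [Fintype V] [DecidableEq V] [DecidableRel G.Adj]
    (hG : G.Connected) {v₀ : V} {c : G.Walk v₀ v₀}
    (hc : c.IsCycle)
    (huniq : ∀ (u : V) (c' : G.Walk u u), c'.IsCycle →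
      c'.support.toFinset = c.support.toFinset) {idx : V → ℕ}
    (hlt : ∀ v, idx v < c.length)
    (hroot : ∀ i < c.length, idx (c.getVert i) = i)
    (hiff : ∀ u v, idx u = idx v ↔ (forest c).Reachable u v)
    (hdist : ∀ u v, idx u = idx v → (forest c).dist u v = G.dist u v)
    (hform : ∀ u v, idx u ≠ idx v → G.dist u v = G.dist u (c.getVert (idx u)) +
        cyc c.length (idx u) (idx v) + G.dist (c.getVert (idx v)) v)
    (W : Set V) (hleaf : ∀ x, G.degree x = 1 → x ∈ W)
    (hP : ∀ i j, i < c.length → j < c.length → i ≠ j → ∃ p ∈ W, ∃ q ∈ W,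
      (cyc c.length i (idx p) : ℤ) - cyc c.length j (idx p) ≠
        cyc c.length i (idx q) - cyc c.length j (idx q)) :
    IsDoublyResolvingSet G W := by
  have hm := hc.three_le_length
  have hext := fun {u v : V} => extendG (u := u) (v := v) hc huniq hlt hroot hiff hdist
  have hgate : ∀ u w, idx u ≠ idx w → G.dist u w =
      G.dist u (c.getVert (idx u)) + G.dist (c.getVert (idx u)) w := by
    intro u w h
    have h1 := hform u w h
    have h2 := hform (c.getVert (idx u)) w (by rw [hroot _ (hlt u)]; exact h)
    rw [hroot _ (hlt u), dist_self] at h2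
    omega
  have hcomm : ∀ a b, G.dist a b = G.dist b a := fun a b => dist_comm
  have hother : ∀ i, ∃ w ∈ W, idx w ≠ i := by
    intro i
    obtain ⟨p, hp, q, hq, hne⟩ := hP 0 1 (by omega) (by omega) (by omega)
    by_cases h : idx p = i
    · refine ⟨q, hq, fun h' => hne ?_⟩
      rw [h, h']
    · exact ⟨p, hp, h⟩
  -- same tree
  have W1 : ∀ u v, u ≠ v → idx u = idx v → ∃ w ∈ W, G.dist v w = G.dist v u + G.dist u w := by
    intro u v huv hi
    obtain ⟨x, hxi, hd, hx | hx⟩ := hext huv hi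
    · obtain ⟨w, hw, hwi⟩ := hother (idx u)
      refine ⟨w, hw, ?_⟩
      have h1 := hgate u w hwi.symm
      have h2 := hgate v w (by omega)
      rw [← hi, ← hx] at h2
      rw [← hx] at h1
      omega
    · exact ⟨x, hleaf x hx, hd⟩
  -- descending from the cycle
  have W3 : ∀ u, u ≠ c.getVert (idx u) → ∃ w ∈ W, idx w = idx u ∧
      G.dist (c.getVert (idx u)) w = G.dist (c.getVert (idx u)) u + G.dist u w := by
    intro u hu
    obtain ⟨x, hxi, hd, hx | hx⟩ := hext hu (hroot _ (hlt u)).symm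
    · rw [← hx, dist_self] at hd
      have := (hG.dist_eq_zero_iff (u := x) (v := u)).1 (by omega)
      exact absurd (this.symm.trans hx) hu
    · exact ⟨x, hleaf x hx, hxi, hd⟩
  have W2 : ∀ u v, idx u ≠ idx v → (∃ w ∈ W, idx w = idx u) → ∃ w ∈ W, idx w = idx u ∧
      G.dist v w = G.dist v u + G.dist u w := by
    intro u v hi ⟨w₀, hw₀, hwi⟩
    have : ∃ w ∈ W, idx w = idx u ∧
        G.dist (c.getVert (idx u)) w = G.dist (c.getVert (idx u)) u + G.dist u w := by
      by_cases hu : u = c.getVert (idx u)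
      · refine ⟨w₀, hw₀, hwi, ?_⟩
        rw [← hu, dist_self, zero_add]
      · exact W3 u hu
    obtain ⟨w, hw, hwi, hd⟩ := this
    refine ⟨w, hw, hwi, ?_⟩
    have h1 := hform v w (by omega)
    have h2 := hform v u (by omega)
    rw [hwi] at h1
    omega
  -- one index not seen by `W`
  have W4 : ∀ u v, idx u ≠ idx v → (¬ ∃ w ∈ W, idx w = idx u) →
      ∃ x ∈ W, ∃ y ∈ W, doublyResolves G x y u v := by
    intro u v hi hno
    have hu : u = c.getVert (idx u) := by
      by_contra hu
      obtain ⟨w, hw, hwi, -⟩ := W3 u hu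
      exact hno ⟨w, hw, hwi⟩
    have hu0 : G.dist u (c.getVert (idx u)) = 0 := by rw [← hu, dist_self]
    have huv := hform u v hi
    have hval : ∀ p ∈ W, ∃ w ∈ W, (idx p ≠ idx v ∧ (G.dist u w : ℤ) - G.dist v w =
        cyc c.length (idx u) (idx p) - cyc c.length (idx v) (idx p)
          - G.dist v (c.getVert (idx v))) ∨ (idx p = idx v ∧
        (G.dist u w : ℤ) - G.dist v w = G.dist u v) := by
      intro p hp
      by_cases hpv : idx p = idx v
      · obtain ⟨w, hw, hwi, hd⟩ := W2 v u hi.symm ⟨p, hp, hpv⟩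
        refine ⟨w, hw, Or.inr ⟨hpv, by omega⟩⟩
      · have hpu : idx u ≠ idx p := fun h => hno ⟨p, hp, h.symm⟩
        have h1 := hform u p hpu
        have h2 := hform v p (by omega)
        exact ⟨p, hp, Or.inl ⟨hpv, by omega⟩⟩
    obtain ⟨p, hp, q, hq, hne⟩ := hP (idx u) (idx v) (hlt u) (hlt v) hi
    obtain ⟨x, hx, hxv⟩ := hval p hp
    obtain ⟨y, hy, hyv⟩ := hval q hq
    refine ⟨x, hx, y, hy, ?_⟩
    unfold doublyResolves
    intro heq
    have hl1 := hlt u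
    have hl2 := hlt v
    have hl3 := hlt p
    have hl4 := hlt q
    have hvc := hcomm v (c.getVert (idx v))
    rcases hxv with ⟨a1, a2⟩ | ⟨a1, a2⟩ <;> rcases hyv with ⟨b1, b2⟩ | ⟨b1, b2⟩
    · omega
    · rw [b1, cyc_self] at hne
      have := cyc_tri (i := idx u) (j := idx v) (k := idx p) hl1 hl2 hl3
      omega
    · rw [a1, cyc_self] at hne
      have := cyc_tri (i := idx u) (j := idx v) (k := idx q) hl1 hl2 hl4
      omega
    · rw [a1, b1] at hne
      exact hne rfl
  intro u v huv
  by_cases hi : idx u = idx v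
  · obtain ⟨x, hx, hxd⟩ := W1 u v huv hi
    obtain ⟨y, hy, hyd⟩ := W1 v u huv.symm hi.symm
    refine ⟨x, hx, y, hy, ?_⟩
    have := hG.pos_dist_of_ne huv
    have := hcomm u v
    unfold doublyResolves
    omega
  · by_cases hu : ∃ w ∈ W, idx w = idx u
    · by_cases hv : ∃ w ∈ W, idx w = idx v
      · obtain ⟨x, hx, -, hxd⟩ := W2 u v hi hu
        obtain ⟨y, hy, -, hyd⟩ := W2 v u (Ne.symm hi) hv
        refine ⟨x, hx, y, hy, ?_⟩
        have := hG.pos_dist_of_ne huv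
        have := hcomm u v
        unfold doublyResolves
        omega
      · obtain ⟨x, hx, y, hy, h⟩ := W4 v u (Ne.symm hi) hv
        refine ⟨x, hx, y, hy, ?_⟩
        unfold doublyResolves at *
        omega
    · exact W4 u v hi hu

lemma leaf_mem [Fintype V] [DecidableRel G.Adj] (hG : G.Connected) {W : Set V}
    (hW : IsDoublyResolvingSet G W) {l : V} (hl : G.degree l = 1) : l ∈ W := by
  by_contra hlW
  obtain ⟨p, hp, hup⟩ := degree_eq_one_iff_existsUnique_adj.1 hl
  have key : ∀ x, x ≠ l → G.dist l x = G.dist p x + 1 := by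
    intro x hx
    obtain ⟨w, hw⟩ := hG.exists_walk_length_eq_dist l x
    have h1 := hG.dist_triangle (u := l) (v := p) (w := x)
    rw [dist_eq_one_iff_adj.2 hp] at h1
    cases w with
    | nil => exact absurd rfl hx
    | cons h q =>
      have := hup _ h
      subst this
      have h2 := dist_le q
      rw [Walk.length_cons] at hw
      omega
  obtain ⟨x, hx, y, hy, h⟩ := hW l p hp.ne
  have h1 := key x (fun e => hlW (e ▸ hx))
  have h2 := key y (fun e => hlW (e ▸ hy))
  unfold doublyResolves at h
  omega

lemma psi_le {W : Finset V} (hW : IsDoublyResolvingSet G (W : Set V)) : psi G ≤ W.card :=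
  Nat.sInf_le ⟨W, rfl, hW⟩

lemma univ_resolving [Fintype V] (hG : G.Connected) :
    IsDoublyResolvingSet G ((Finset.univ : Finset V) : Set V) := by
  intro u v huv
  refine ⟨u, by simp, v, by simp, ?_⟩
  have := hG.pos_dist_of_ne huv
  have h : G.dist u v = G.dist v u := dist_comm
  simp only [doublyResolves, dist_self]
  omega

lemma le_psi [Fintype V] [DecidableRel G.Adj] (hG : G.Connected) :
    (Finset.univ.filter fun v : V => G.degree v = 1).card ≤ psi G := by
  obtain ⟨W, hWc, hW⟩ : psi G ∈ {k | ∃ W : Finset V, W.card = k ∧ IsDoublyResolvingSet G ↑W} :=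
    Nat.sInf_mem ⟨_, Finset.univ, rfl, univ_resolving hG⟩
  rw [← hWc]
  apply Finset.card_le_card
  intro x hx
  exact Finset.mem_coe.1 (leaf_mem hG hW (Finset.mem_filter.1 hx).2)

lemma cyc_odd {k i j : ℕ} (hi : i < 2 * k + 1) (hj : j < 2 * k + 1) (hij : i ≠ j) :
    (cyc (2 * k + 1) i 0 : ℤ) - cyc (2 * k + 1) j 0 ≠
      cyc (2 * k + 1) i k - cyc (2 * k + 1) j k := by
  unfold cyc
  omega

lemma cyc_even {k i j : ℕ} (hk : 2 ≤ k) (hi : i < 2 * k) (hj : j < 2 * k) (hij : i ≠ j) :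
    (cyc (2 * k) i 0 : ℤ) - cyc (2 * k) j 0 ≠ cyc (2 * k) i k - cyc (2 * k) j k ∨
    (cyc (2 * k) i 0 : ℤ) - cyc (2 * k) j 0 ≠ cyc (2 * k) i 1 - cyc (2 * k) j 1 := by
  have key : ∀ i < 2 * k, (i = 0 ∧ cyc (2 * k) i 0 = 0 ∧ cyc (2 * k) i k = k ∧
      cyc (2 * k) i 1 = 1) ∨ (1 ≤ i ∧ i ≤ k ∧ cyc (2 * k) i 0 = i ∧ cyc (2 * k) i k = k - i ∧
      cyc (2 * k) i 1 = i - 1) ∨ (k < i ∧ cyc (2 * k) i 0 = 2 * k - i ∧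
      cyc (2 * k) i k = i - k ∧ cyc (2 * k) i 1 = 2 * k - i + 1) := by
    intro i hi
    rcases Nat.eq_zero_or_pos i with h | h
    · left
      subst h
      unfold cyc
      omega
    · right
      rcases Nat.lt_or_ge k i with h' | h'
      · right
        unfold cyc
        omega
      · left
        unfold cyc
        omega
  rcases key i hi with h | h | h <;> rcases key j hj with h' | h' | h' <;> omega

/-- The upper bounds, for a cycle based at the root of a nontrivial tree. -/
theorem upper [Fintype V] [DecidableEq V] [DecidableRel G.Adj]
    (hG : G.Connected) {v₀ : V} {c : G.Walk v₀ v₀} (hc : c.IsCycle)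
    (huniq : ∀ (u : V) (c' : G.Walk u u), c'.IsCycle →
      c'.support.toFinset = c.support.toFinset)
    {v : V} (hv : v ∉ c.support) (hr : (forest c).Reachable v v₀) :
    (Odd c.length →
        psi G ≤ (Finset.univ.filter fun v : V => G.degree v = 1).card + 1) ∧
      (Even c.length →
        psi G ≤ (Finset.univ.filter fun v : V => G.degree v = 1).card + 2) := by
  obtain ⟨idx, hlt, hroot, hiff, hdist, hform⟩ := structure_thm hG hc huniq
  have hm := hc.three_le_length
  have h0 : idx v₀ = 0 := by simpa using hroot 0 (by omega)
  have hv0 : idx v = idx v₀ := (hiff _ _).2 hr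
  obtain ⟨x, hxi, hxl⟩ : ∃ x, idx x = 0 ∧ G.degree x = 1 := by
    have hne : v ≠ v₀ := fun h => hv (h ▸ c.start_mem_support)
    obtain ⟨x, hxi, hd, hx | hx⟩ := extendG hc huniq hlt hroot hiff hdist hne hv0
    · rw [hv0, h0, Walk.getVert_zero] at hx
      rw [hx, dist_self] at hd
      exact absurd ((hG.dist_eq_zero_iff (u := v₀) (v := v)).1 (by omega)).symm hne
    · exact ⟨x, by omega, hx⟩
  have hmain := fun (W : Finset V) => main_resolve hG hc huniq hlt hroot hiff hdist hform (W : Set V)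
  constructor
  · rintro ⟨k, hk⟩
    have h1 := psi_le (hmain (insert (c.getVert k)
      (Finset.univ.filter fun v : V => G.degree v = 1)) (by intro x hx; simp [hx]) (by
        intro i j hi hj hij
        refine ⟨x, by simp [hxl], c.getVert k, by simp, ?_⟩
        rw [hxi, hroot k (by omega), hk]
        exact cyc_odd (by omega) (by omega) hij))
    exact h1.trans (Finset.card_insert_le _ _)
  · rintro ⟨k, hk⟩
    have hk : c.length = 2 * k := by omega
    have h1 := psi_le (hmain (insert (c.getVert 1) (insert (c.getVert k)
      (Finset.univ.filter fun v : V => G.degree v = 1))) (by intro x hx; simp [hx]) (by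
        intro i j hi hj hij
        rcases cyc_even (k := k) (i := i) (j := j) (by omega) (by omega) (by omega) hij with h | h
        · refine ⟨x, by simp [hxl], c.getVert k, by simp, ?_⟩
          rw [hxi, hroot k (by omega), hk]
          exact h
        · refine ⟨x, by simp [hxl], c.getVert 1, by simp, ?_⟩
          rw [hxi, hroot 1 (by omega), hk]
          exact h))
    have h2 := Finset.card_insert_le (c.getVert 1) (insert (c.getVert k)
      (Finset.univ.filter fun v : V => G.degree v = 1))
    have h3 := Finset.card_insert_le (c.getVert k)
      (Finset.univ.filter fun v : V => G.degree v = 1)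
    omega

end Unicyc

/-- Let `G` be a connected unicyclic graph that is not a cycle, with unique cycle `c`
of length `m`. Then `l(G) ≤ ψ(G)`, and `ψ(G) ≤ l(G) + 1` if `m` is odd, while
`ψ(G) ≤ l(G) + 2` if `m` is even, where `l(G)` is the number of leaves of `G`. -/
theorem stmt_14 {V : Type*} [Fintype V] [DecidableEq V] (G : SimpleGraph V)
    [DecidableRel G.Adj] (hG : G.Connected)
    (v₀ : V) (c : G.Walk v₀ v₀) (hc : c.IsCycle)
    (huniq : ∀ (u : V) (c' : G.Walk u u), c'.IsCycle →
      c'.support.toFinset = c.support.toFinset)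
    (hnotcycle : ∃ v : V, v ∉ c.support) :
    (Finset.univ.filter fun v : V => G.degree v = 1).card ≤ psi G ∧
      (Odd c.length →
        psi G ≤ (Finset.univ.filter fun v : V => G.degree v = 1).card + 1) ∧
      (Even c.length →
        psi G ≤ (Finset.univ.filter fun v : V => G.degree v = 1).card + 2) := by
  refine ⟨Unicyc.le_psi hG, ?_⟩
  obtain ⟨v, hv⟩ := hnotcycle
  obtain ⟨i, hi, hr⟩ := Unicyc.exists_root c hc hG v
  have ha : c.getVert i ∈ c.support := c.getVert_mem_support i
  have hE : ∀ e, e ∈ (c.rotate _ ha).edges ↔ e ∈ c.edges := fun e =>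
    (c.rotate_edges _ ha).perm.mem_iff
  have hf : Unicyc.forest (c.rotate _ ha) = Unicyc.forest c := by
    ext a b
    rw [Unicyc.forest_adj, Unicyc.forest_adj, hE]
  have hs : (c.rotate _ ha).support.toFinset = c.support.toFinset := by
    ext x
    simp
  have := Unicyc.upper hG (c := c.rotate _ ha) (by simpa using hc)
    (fun u c' hc' => (huniq u c' hc').trans hs.symm) (v := v) (by simpa using hv)
    (by rw [hf]; exact hr)
  rw [Walk.length_rotate] at this
  exact this
end
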